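/- For every sufficiently large n there exists an origin-symmetric ellipsoid E ⊂ R^n with E ∩ Z^n = {0} whose boundary ∂E contains at least n(n+1) points of Z^n. -/

import Mathlib

/- STATEMENT 3: For every sufficiently large n there exists an origin-symmetric ellipsoid
E ⊂ R^n with E ∩ Z^n = {0} whose boundary ∂E contains at least n(n+1) points of Z^n. -/

open MeasureTheory
noncomputable section

abbrev Euc (n : ℕ) := EuclideanSpace ℝ (Fin n)

/-- The integer lattice points `ℤ^n ⊂ ℝ^n`. -/
def intPoints (n : ℕ) : Set (Euc n) := {x | ∀ i, ∃ m : ℤ, x i = (m : ℝ)}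

/-- The positive-definite square root of the linear map with matrix `(I + J) / 2`, where `J` is the
all-ones matrix; `I + J` is a Gram matrix of the root lattice `A_n`. -/
def rootMap (n : ℕ) : Euc n →ₗ[ℝ] Euc n where
  toFun x := WithLp.toLp 2 fun i => (x i + (1 + √(n + 1))⁻¹ * ∑ j, x j) / √2
  map_add' x y := by
    ext i
    simp only [PiLp.add_apply, Finset.sum_add_distrib]
    ring
  map_smul' a x := by
    ext i
    simp only [PiLp.smul_apply, smul_eq_mul, ← Finset.mul_sum, RingHom.id_apply]
    ring

theorem norm_rootMap_sq {n : ℕ} (x : Euc n) :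
    ‖rootMap n x‖ ^ 2 = (∑ i, x i ^ 2 + (∑ i, x i) ^ 2) / 2 := by
  have h2 : √(2 : ℝ) ^ 2 = 2 := Real.sq_sqrt (by norm_num)
  have hn : √((n : ℝ) + 1) ^ 2 = n + 1 := Real.sq_sqrt (by positivity)
  have hpos : 1 + √((n : ℝ) + 1) ≠ 0 := by positivity
  set c := (1 + √((n : ℝ) + 1))⁻¹ with hc
  have hcn : 2 * c + n * c ^ 2 = 1 := by
    rw [hc]
    field_simp
    linarith
  set S := ∑ j, x j with hS
  have key : ∑ i, (x i + c * S) ^ 2 = ∑ i, x i ^ 2 + (2 * c + n * c ^ 2) * S ^ 2 := by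
    have : ∀ i, (x i + c * S) ^ 2 = x i ^ 2 + 2 * c * S * x i + c ^ 2 * S ^ 2 := fun i => by ring
    simp only [this, Finset.sum_add_distrib, ← Finset.mul_sum, ← hS, Finset.sum_const,
      Finset.card_univ, Fintype.card_fin, nsmul_eq_mul]
    ring
  rw [EuclideanSpace.real_norm_sq_eq]
  change ∑ i, ((x i + c * S) / √2) ^ 2 = _
  simp only [div_pow, h2, ← Finset.sum_div]
  rw [key, hcn, one_mul]

theorem sq_apply_le_two_mul_norm_rootMap_sq {n : ℕ} (x : Euc n) (i : Fin n) :
    x i ^ 2 ≤ 2 * ‖rootMap n x‖ ^ 2 := by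
  have h := Finset.single_le_sum (f := fun i => x i ^ 2) (fun i _ => sq_nonneg (x i))
    (Finset.mem_univ i)
  rw [norm_rootMap_sq]
  nlinarith [sq_nonneg (∑ i, x i)]

theorem rootMap_injective (n : ℕ) : Function.Injective (rootMap n) := by
  rw [← LinearMap.ker_eq_bot, LinearMap.ker_eq_bot']
  intro x hx
  ext i
  have h := sq_apply_le_two_mul_norm_rootMap_sq x i
  rw [hx, norm_zero] at h
  simpa using (sq_nonpos_iff (x i)).1 (by simpa using h)

theorem even_sum_sq_add_sq_sum {ι : Type*} (s : Finset ι) (m : ι → ℤ) :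
    Even (∑ i ∈ s, m i ^ 2 + (∑ i ∈ s, m i) ^ 2) := by
  have h : Even (∑ i ∈ s, (m i ^ 2 + m i)) :=
    Finset.even_sum _ fun i _ => by
      simpa [pow_two, mul_add] using Int.even_mul_succ_self (m i)
  have h' : Even ((∑ i ∈ s, m i) ^ 2 - ∑ i ∈ s, m i) := by
    simpa [pow_two, mul_sub] using Int.even_mul_pred_self (∑ i ∈ s, m i)
  rw [Finset.sum_add_distrib] at h
  have heq : ∑ i ∈ s, m i ^ 2 + (∑ i ∈ s, m i) ^ 2 = (∑ i ∈ s, m i ^ 2 + ∑ i ∈ s, m i) +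
      ((∑ i ∈ s, m i) ^ 2 - ∑ i ∈ s, m i) := by ring
  rw [heq]
  exact h.add h'

theorem eq_zero_of_mem_intPoints_of_norm_rootMap_lt {n : ℕ} {x : Euc n} (hx : x ∈ intPoints n)
    (h : ‖rootMap n x‖ < 1) : x = 0 := by
  choose m hm using hx
  have hsq : ‖rootMap n x‖ ^ 2 < 1 := by nlinarith [norm_nonneg (rootMap n x)]
  rw [norm_rootMap_sq] at hsq
  simp only [hm] at hsq
  have hlt : ∑ i, m i ^ 2 + (∑ i, m i) ^ 2 < 2 := by
    have : ∑ i, (m i : ℝ) ^ 2 + (∑ i, (m i : ℝ)) ^ 2 < 2 := by linarith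
    exact_mod_cast this
  have hnn : 0 ≤ ∑ i, m i ^ 2 := Finset.sum_nonneg fun i _ => sq_nonneg (m i)
  have hzero : ∑ i, m i ^ 2 = 0 := by
    obtain ⟨k, hk⟩ := even_sum_sq_add_sq_sum Finset.univ m
    have := sq_nonneg (∑ i, m i)
    omega
  ext i
  have hi := (Finset.sum_eq_zero_iff_of_nonneg fun i _ => sq_nonneg (m i)).1 hzero i
    (Finset.mem_univ i)
  simp [hm, pow_eq_zero_iff two_ne_zero |>.1 hi]

theorem finite_norm_rootMap_eq_one (n : ℕ) :
    {x ∈ intPoints n | ‖rootMap n x‖ = 1}.Finite := by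
  refine ((Set.finite_Icc (fun _ => -2 : Fin n → ℤ) (fun _ => 2)).image
    fun m => (WithLp.toLp 2 fun i => (m i : ℝ) : Euc n)).subset ?_
  rintro x ⟨hx, h⟩
  choose m hm using hx
  have hb : ∀ i, -2 ≤ m i ∧ m i ≤ 2 := fun i => by
    have hi := sq_apply_le_two_mul_norm_rootMap_sq x i
    rw [h, hm] at hi
    have : m i ^ 2 ≤ 2 := by exact_mod_cast (by linarith : (m i : ℝ) ^ 2 ≤ 2)
    constructor <;> nlinarith
  refine ⟨m, ⟨fun i => (hb i).1, fun i => (hb i).2⟩, ?_⟩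
  ext i
  simp [hm]

/-- The roots of `A_n`: the vector `e_i - e_j`, where `e_none = 0`. -/
def rootVec {n : ℕ} (p : Option (Fin n) × Option (Fin n)) : Euc n :=
  WithLp.toLp 2 fun k => (if p.1 = some k then 1 else 0) - (if p.2 = some k then 1 else 0)

theorem rootVec_mem_intPoints {n : ℕ} (p : Option (Fin n) × Option (Fin n)) :
    rootVec p ∈ intPoints n := fun k =>
  ⟨(if p.1 = some k then 1 else 0) - (if p.2 = some k then 1 else 0), by simp [rootVec]⟩

theorem norm_rootMap_rootVec {n : ℕ} {p : Option (Fin n) × Option (Fin n)} (hp : p.1 ≠ p.2) :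
    ‖rootMap n (rootVec p)‖ = 1 := by
  rw [← sq_eq_sq₀ (norm_nonneg _) zero_le_one, norm_rootMap_sq]
  have hsq : ∀ k, rootVec p k ^ 2 =
      (if p.1 = some k then 1 else 0) + (if p.2 = some k then 1 else 0) := fun k => by
    by_cases h₁ : p.1 = some k <;> by_cases h₂ : p.2 = some k
    · exact absurd (h₁.trans h₂.symm) hp
    all_goals simp [rootVec, h₁, h₂]
  simp only [hsq, Finset.sum_add_distrib]
  obtain ⟨_ | i, _ | j⟩ := p
  · exact absurd rfl hp
  all_goals
    simp only [rootVec, Finset.sum_sub_distrib, reduceCtorEq, if_false, Option.some.injEq,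
      Finset.sum_ite_eq, Finset.mem_univ, if_true, Finset.sum_const_zero]
    norm_num

theorem rootVec_eq_one_iff {n : ℕ} {p : Option (Fin n) × Option (Fin n)} (hp : p.1 ≠ p.2)
    (k : Fin n) : rootVec p k = 1 ↔ p.1 = some k := by
  by_cases h₁ : p.1 = some k <;> by_cases h₂ : p.2 = some k
  · exact absurd (h₁.trans h₂.symm) hp
  all_goals norm_num [rootVec, h₁, h₂]

theorem rootVec_eq_neg_one_iff {n : ℕ} {p : Option (Fin n) × Option (Fin n)} (hp : p.1 ≠ p.2)
    (k : Fin n) : rootVec p k = -1 ↔ p.2 = some k := by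
  by_cases h₁ : p.1 = some k <;> by_cases h₂ : p.2 = some k
  · exact absurd (h₁.trans h₂.symm) hp
  all_goals norm_num [rootVec, h₁, h₂]

theorem injOn_rootVec (n : ℕ) :
    Set.InjOn rootVec {p : Option (Fin n) × Option (Fin n) | p.1 ≠ p.2} := by
  intro p hp q hq h
  refine Prod.ext (Option.ext fun k => ?_) (Option.ext fun k => ?_)
  · rw [← rootVec_eq_one_iff hp, ← rootVec_eq_one_iff hq, h]
  · rw [← rootVec_eq_neg_one_iff hp, ← rootVec_eq_neg_one_iff hq, h]

theorem le_ncard_norm_rootMap_eq_one (n : ℕ) :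
    n * (n + 1) ≤ {x ∈ intPoints n | ‖rootMap n x‖ = 1}.ncard := by
  classical
  let s : Finset (Option (Fin n) × Option (Fin n)) := Finset.univ.offDiag
  have hs : ∀ p ∈ s, p.1 ≠ p.2 := fun p hp => (Finset.mem_offDiag.1 hp).2.2
  have hcard : (rootVec '' (s : Set (Option (Fin n) × Option (Fin n)))).ncard = n * (n + 1) := by
    rw [((injOn_rootVec n).mono hs).ncard_image, Set.ncard_coe_finset,
      Finset.offDiag_card, Finset.card_univ, Fintype.card_option, Fintype.card_fin,
      Nat.sub_eq_iff_eq_add (Nat.le_mul_self _)]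
    ring
  rw [← hcard]
  refine Set.ncard_le_ncard ?_ (finite_norm_rootMap_eq_one n)
  rintro _ ⟨p, hp, rfl⟩
  exact ⟨rootVec_mem_intPoints p, norm_rootMap_rootVec (hs p hp)⟩

theorem exists_ellipsoid_with_many_boundary_lattice_points :
    ∃ N : ℕ, ∀ n : ℕ, N ≤ n →
      ∃ T : Euc n ≃ₗ[ℝ] Euc n,
        (T '' Metric.ball (0 : Euc n) 1) ∩ intPoints n ⊆ {0} ∧
        n * (n + 1) ≤ (frontier (T '' Metric.ball (0 : Euc n) 1) ∩ intPoints n).ncard := by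
  refine ⟨0, fun n _ => ?_⟩
  let S : Euc n ≃ₗ[ℝ] Euc n := LinearEquiv.ofInjectiveEndo (rootMap n) (rootMap_injective n)
  have hS : ∀ x, S x = rootMap n x := fun _ => rfl
  have himage : S.symm '' Metric.ball 0 1 = S ⁻¹' Metric.ball 0 1 :=
    S.symm.toEquiv.image_eq_preimage_symm _
  have hfrontier : frontier (S ⁻¹' Metric.ball 0 1) = S ⁻¹' Metric.sphere 0 1 := by
    rw [← frontier_ball _ one_ne_zero]
    exact (S.toContinuousLinearEquiv.toHomeomorph.preimage_frontier _).symm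
  refine ⟨S.symm, ?_, ?_⟩
  · rw [himage]
    rintro x ⟨hx, hint⟩
    exact eq_zero_of_mem_intPoints_of_norm_rootMap_lt hint (by simpa [hS] using hx)
  · rw [himage, hfrontier]
    convert le_ncard_norm_rootMap_eq_one n using 2
    ext x
    simp [hS, and_comm]
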